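/- arXiv:1610.07471 — 2 statements merged into one kernel-verified Lean document; each statement's English description precedes it below -/
import Mathlib

section
/- Assume that every even integer at least 8 is the sum of two distinct primes. Then for every odd positive integer n with n ≠ 5, the inverse orbit of n under s, namely the set {m ∈ ℕ : m ≥ 1 and s^[k](m) = n for some integer k ≥ 0}, is infinite (here s^[k] denotes the k-fold iterate of s). -/
/-- The sum of all positive divisors of `n`. -/
def sigma (n : ℕ) : ℕ := ∑ d ∈ n.divisors, d

/-- The sum of the proper divisors of `n`. -/
def s (n : ℕ) : ℕ := sigma n - n

theorem s_prime {p : ℕ} (hp : p.Prime) : s p = 1 := by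
  simp [s, sigma, hp.sum_divisors]

theorem s_mul_of_primes {p q : ℕ} (hp : p.Prime) (hq : q.Prime) (hpq : p ≠ q) :
    s (p * q) = p + q + 1 := by
  have hc : p.Coprime q := (Nat.coprime_primes hp hq).2 hpq
  rw [s, sigma, hc.sum_divisors_mul, hp.sum_divisors (f := fun d ↦ d),
    hq.sum_divisors (f := fun d ↦ d)]
  have h : (p + 1) * (q + 1) = p * q + (p + q + 1) := by ring
  rw [h, Nat.add_sub_cancel_left]

/-- Under Goldbach's conjecture for distinct primes, every odd number from `9` on
has a larger odd preimage under `s`. -/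
theorem exists_odd_preimage_gt
    (hG : ∀ N : ℕ, Even N → 8 ≤ N → ∃ p q : ℕ, p.Prime ∧ q.Prime ∧ p ≠ q ∧ N = p + q)
    {x : ℕ} (hx : Odd x) (hx9 : 9 ≤ x) : ∃ y, Odd y ∧ x < y ∧ s y = x := by
  obtain ⟨p, q, hp, hq, hpq, h⟩ := hG (x - 1) (Nat.Odd.sub_odd hx odd_one) (by omega)
  have hx1 : x = p + q + 1 := by omega
  have hpar : Even (p + q) := by
    rw [← h]
    exact Nat.Odd.sub_odd hx odd_one
  have hp_odd : Odd p := by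
    rcases hp.eq_two_or_odd' with rfl | h
    · exact absurd ((hq.even_iff).1 ((Nat.even_add.1 hpar).1 even_two)).symm hpq
    · exact h
  have hq_odd : Odd q := (Nat.even_add'.1 hpar).1 hp_odd
  have hp3 : 3 ≤ p := by
    have := hp.two_le
    obtain ⟨k, rfl⟩ := hp_odd
    omega
  have hq3 : 3 ≤ q := by
    have := hq.two_le
    obtain ⟨k, rfl⟩ := hq_odd
    omega
  exact ⟨p * q, hp_odd.mul hq_odd, by nlinarith, hx1 ▸ s_mul_of_primes hp hq hpq⟩

theorem inverse_orbit_infinite_of_odd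
    (hG : ∀ N : ℕ, Even N → 8 ≤ N → ∃ p q : ℕ, p.Prime ∧ q.Prime ∧ p ≠ q ∧ N = p + q)
    {n x : ℕ} (hx : Odd x) (hx9 : 9 ≤ x) (hxn : ∃ k : ℕ, s^[k] x = n) :
    {m : ℕ | 1 ≤ m ∧ ∃ k : ℕ, s^[k] m = n}.Infinite := by
  have key : ∀ a : ℕ, ∃ b, Odd b ∧ 9 ≤ b ∧ a < b ∧ ∃ k : ℕ, s^[k] b = n := by
    intro a
    induction a with
    | zero => exact ⟨x, hx, hx9, by omega, hxn⟩
    | succ a ih =>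
      obtain ⟨b, hb, hb9, hab, k, hk⟩ := ih
      obtain ⟨y, hy, hby, hsy⟩ := exists_odd_preimage_gt hG hb hb9
      exact ⟨y, hy, by omega, by omega, k + 1, by rw [Function.iterate_succ_apply, hsy, hk]⟩
  refine Set.infinite_of_forall_exists_gt fun a ↦ ?_
  obtain ⟨b, -, hb9, hab, hk⟩ := key a
  exact ⟨b, ⟨by omega, hk⟩, hab⟩

theorem inverse_orbit_infinite_of_goldbach
    (hG : ∀ N : ℕ, Even N → 8 ≤ N → ∃ p q : ℕ, p.Prime ∧ q.Prime ∧ p ≠ q ∧ N = p + q)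
    (n : ℕ) (hn : Odd n) (hn0 : 0 < n) (hn5 : n ≠ 5) :
    {m : ℕ | 1 ≤ m ∧ ∃ k : ℕ, s^[k] m = n}.Infinite := by
  rcases le_or_gt 9 n with h9 | h9
  · exact inverse_orbit_infinite_of_odd hG hn h9 ⟨0, rfl⟩
  have hcases : n = 1 ∨ n = 3 ∨ n = 7 := by
    obtain ⟨k, rfl⟩ := hn
    omega
  rcases hcases with rfl | rfl | rfl
  · exact Nat.infinite_setOfPred_prime.mono fun p hp ↦ ⟨Nat.Prime.one_le hp, 1, s_prime hp⟩
  · exact inverse_orbit_infinite_of_odd hG (x := 9) (by decide) le_rfl ⟨2, by decide +kernel⟩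
  · exact inverse_orbit_infinite_of_odd hG (x := 49) (by decide) (by norm_num)
      ⟨2, by decide +kernel⟩
end

section
/- Let a > 1 be an integer, and let p and q be distinct primes neither of which divides a. Set n = s(apq), g = gcd(σ(a), s(a)), u = σ(a)/g, and v = s(a)/g. Then g divides n, g divides a·u + n·v, and (v·p + u)·(v·q + u) = (a·u + n·v)/g. -/
theorem sigma_mul_of_coprime {m n : ℕ} (h : m.Coprime n) :
    sigma (m * n) = sigma m * sigma n :=
  h.sum_divisors_mul

theorem sigma_prime {p : ℕ} (hp : p.Prime) : sigma p = p + 1 := by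
  simp [sigma, hp.sum_divisors]

theorem le_sigma {n : ℕ} (hn : n ≠ 0) : n ≤ sigma n :=
  Finset.single_le_sum (f := fun d => d) (fun _ _ => Nat.zero_le _) (Nat.mem_divisors_self n hn)

theorem s_add_self {n : ℕ} (hn : n ≠ 0) : s n + n = sigma n :=
  Nat.sub_add_cancel (le_sigma hn)

theorem sigma_mul_two_primes {a p q : ℕ} (hp : p.Prime) (hq : q.Prime) (hpq : p ≠ q)
    (hpa : ¬ p ∣ a) (hqa : ¬ q ∣ a) :
    sigma (a * p * q) = sigma a * (p + 1) * (q + 1) := by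
  have hap : a.Coprime p := ((Nat.Prime.coprime_iff_not_dvd hp).2 hpa).symm
  have haq : a.Coprime q := ((Nat.Prime.coprime_iff_not_dvd hq).2 hqa).symm
  have hpq' : p.Coprime q := (Nat.coprime_primes hp hq).2 hpq
  rw [sigma_mul_of_coprime (haq.mul_left hpq'), sigma_mul_of_coprime hap, sigma_prime hp,
    sigma_prime hq]

theorem semiprime_factor_identity (a p q n g u v : ℕ) (ha : 1 < a)
    (hp : p.Prime) (hq : q.Prime) (hpq : p ≠ q) (hpa : ¬ p ∣ a) (hqa : ¬ q ∣ a)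
    (hn : n = s (a * p * q)) (hg : g = Nat.gcd (sigma a) (s a))
    (hu : u = sigma a / g) (hv : v = s a / g) :
    g ∣ n ∧ g ∣ a * u + n * v ∧
      (v * p + u) * (v * q + u) = (a * u + n * v) / g := by
  have ha0 : a ≠ 0 := by omega
  have hsa := s_add_self ha0
  have hsn : n + a * p * q = sigma a * (p + 1) * (q + 1) := by
    rw [hn, s_add_self (mul_ne_zero (mul_ne_zero ha0 hp.ne_zero) hq.ne_zero),
      sigma_mul_two_primes hp hq hpq hpa hqa]
  have hgσ : g ∣ sigma a := hg ▸ Nat.gcd_dvd_left _ _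
  have hgs : g ∣ s a := hg ▸ Nat.gcd_dvd_right _ _
  have hg0 : 0 < g := Nat.pos_of_dvd_of_pos hgσ (by have := le_sigma ha0; omega)
  have hσu : sigma a = g * u := by rw [hu, Nat.mul_div_cancel' hgσ]
  have hsv : s a = g * v := by rw [hv, Nat.mul_div_cancel' hgs]
  obtain ⟨w, hw⟩ : g ∣ a := (Nat.dvd_add_right hgs).1 (hsa ▸ hgσ)
  obtain ⟨m, hm⟩ : g ∣ n := by
    refine (Nat.dvd_add_left (b := n) (c := a * p * q) ?_).1 ?_
    · exact ((Dvd.intro w hw.symm).mul_right p).mul_right q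
    · exact hsn ▸ (hgσ.mul_right _).mul_right _
  have huw : v + w = u := Nat.eq_of_mul_eq_mul_left hg0 (by rw [← hσu, ← hsa, hsv, mul_add, ← hw])
  have hmw : m + w * p * q = u * (p + 1) * (q + 1) := by
    refine Nat.eq_of_mul_eq_mul_left hg0 ?_
    rw [hσu, hm, hw] at hsn
    linear_combination hsn
  have hsum : a * u + n * v = g * ((v * p + u) * (v * q + u)) := by
    rw [hw, hm]
    subst huw
    zify at hmw ⊢
    linear_combination (g : ℤ) * v * hmw
  exact ⟨⟨m, hm⟩, ⟨_, hsum⟩, by rw [hsum, Nat.mul_div_cancel_left _ hg0]⟩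
end
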